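/- Let R_{G,φ} be a uniquely ergodic Cantor minimal G-system with invariant probability measure μ. Then the fundamental group F(R_{G,φ}) is a countable multiplicative subgroup of ℝ₊^× = (ℝ_{>0}, ×): it contains 1, is closed under multiplication, and is closed under taking inverses, and it is a countable set. -/

import Mathlib

open MeasureTheory
open scoped ENNReal

/-- The group of self-homeomorphisms of a space, under composition. -/
instance homeomorphGroup {X : Type*} [TopologicalSpace X] : Group (X ≃ₜ X) where
  mul f g := g.trans f
  one := Homeomorph.refl X
  inv := Homeomorph.symm
  mul_assoc f g h := rfl
  one_mul f := Homeomorph.ext fun x => rfl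
  mul_one f := Homeomorph.ext fun x => rfl
  inv_mul_cancel f := Homeomorph.ext fun x => f.symm_apply_apply x

section Defs

variable {X Y : Type*} [TopologicalSpace X] [TopologicalSpace Y]

/-- The orbit equivalence relation `R_{G,φ}` of an action of `G` on `X` by homeomorphisms. -/
def orbitRelOf {G : Type*} [Group G] (φ : G →* (X ≃ₜ X)) : Set (X × X) :=
  {p | ∃ g : G, φ g p.1 = p.2}

/-- Freeness of an action by homeomorphisms. -/
def IsFreeAction {G : Type*} [Group G] (φ : G →* (X ≃ₜ X)) : Prop :=
  ∀ g : G, g ≠ 1 → ∀ x : X, φ g x ≠ x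

/-- The orbit relation of a single homeomorphism, i.e. of the generated `ℤ`-action. -/
def orbitRelZ (φ : X ≃ₜ X) : Set (X × X) :=
  {p | ∃ n : ℤ, (φ ^ n) p.1 = p.2}

/-- Freeness of the `ℤ`-action generated by a homeomorphism. -/
def IsFreeZ (φ : X ≃ₜ X) : Prop :=
  ∀ n : ℤ, n ≠ 0 → ∀ x : X, (φ ^ n) x ≠ x

/-- Minimality of an orbit equivalence relation: every class `R[x]` is dense. -/
def IsMinimalRel (R : Set (X × X)) : Prop :=
  ∀ x : X, Dense {y : X | (x, y) ∈ R}

/-- A Borel measure is `R`-invariant if it is invariant under every homeomorphism `h`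
with `(x, h x) ∈ R` for all `x`. -/
def IsInvariantMeasure [MeasurableSpace X] (R : Set (X × X)) (μ : Measure X) : Prop :=
  ∀ h : X ≃ₜ X, (∀ x : X, (x, h x) ∈ R) → Measure.map h μ = μ

/-- Restriction `R|_U = R ∩ (U × U)` of a relation, as a relation on the subtype `U`. -/
def restrictRel (R : Set (X × X)) (U : Set X) : Set (↥U × ↥U) :=
  {p | ((p.1 : X), (p.2 : X)) ∈ R}

/-- `R^n` on `X × {1,…,n}`: `((x,i),(y,j)) ∈ R^n ↔ (x,y) ∈ R`. -/
def finProdRel (R : Set (X × X)) (n : ℕ) : Set ((X × Fin n) × (X × Fin n)) :=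
  {p | (p.1.1, p.2.1) ∈ R}

/-- `R^∞` on `X × ℕ`: `((x,i),(y,j)) ∈ R^∞ ↔ (x,y) ∈ R`. -/
def natProdRel (R : Set (X × X)) : Set ((X × ℕ) × (X × ℕ)) :=
  {p | (p.1.1, p.2.1) ∈ R}

/-- Topological orbit equivalence of two equivalence relations: a homeomorphism `F` of the
underlying spaces with `(F × F)(R₁) = R₂`. -/
def OrbitEquiv (R₁ : Set (X × X)) (R₂ : Set (Y × Y)) : Prop :=
  ∃ F : X ≃ₜ Y, ∀ x y : X, (x, y) ∈ R₁ ↔ (F x, F y) ∈ R₂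

/-- The fundamental group `F(R)` of a uniquely ergodic Cantor minimal system, where `μ` is
the unique invariant probability measure: the set of values `(μ × δ)(U)` (with `δ` counting
measure) over clopen sets `U ⊆ X × {1,…,n}`, `n ∈ ℕ`, such that `R^n|_U` is orbit
equivalent to `R`. -/
noncomputable def fundGroup [MeasurableSpace X] (R : Set (X × X)) (μ : Measure X) : Set ℝ :=
  {l : ℝ | ∃ (n : ℕ) (U : Set (X × Fin n)), IsClopen U ∧
    OrbitEquiv R (restrictRel (finProdRel R n) U) ∧
    l = ((μ.prod Measure.count) U).toReal}

/-- `E_μ`: the additive subgroup of `ℝ` generated by the measures of clopen sets. -/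
noncomputable def clopenValueGroup [MeasurableSpace X] (μ : Measure X) : AddSubgroup ℝ :=
  AddSubgroup.closure {r : ℝ | ∃ V : Set X, IsClopen V ∧ r = (μ V).toReal}

/-- The positive inner multiplier group `IM₊(E)` of an additive subgroup of `ℝ`. -/
def IMplus (E : AddSubgroup ℝ) : Set ℝ :=
  {t : ℝ | 0 < t ∧ t ∈ E ∧ t⁻¹ ∈ E ∧ (fun x => t * x) '' (E : Set ℝ) = (E : Set ℝ)}

end Defs

section OrbitRelation

variable {G X : Type*} [Group G] [TopologicalSpace X] {φ : G →* (X ≃ₜ X)}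

theorem orbitRelOf_apply (φ : G →* (X ≃ₜ X)) (g : G) (x : X) : (x, φ g x) ∈ orbitRelOf φ :=
  ⟨g, rfl⟩

theorem orbitRelOf_symm {x y : X} (h : (x, y) ∈ orbitRelOf φ) : (y, x) ∈ orbitRelOf φ := by
  obtain ⟨g, hg⟩ := h
  refine ⟨g⁻¹, ?_⟩
  change φ g x = y at hg
  change φ g⁻¹ y = x
  rw [← hg, map_inv]
  exact (φ g).symm_apply_apply x

theorem orbitRelOf_trans {x y z : X} (h : (x, y) ∈ orbitRelOf φ) (h' : (y, z) ∈ orbitRelOf φ) :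
    (x, z) ∈ orbitRelOf φ := by
  obtain ⟨g, hg⟩ := h
  obtain ⟨k, hk⟩ := h'
  change φ g x = y at hg
  change φ k y = z at hk
  refine ⟨k * g, ?_⟩
  change φ (k * g) x = z
  rw [← hk, ← hg, map_mul]
  rfl

theorem orbitRelOf_congr {x y x' y' : X} (hx : (x, x') ∈ orbitRelOf φ)
    (hy : (y, y') ∈ orbitRelOf φ) : (x, y) ∈ orbitRelOf φ ↔ (x', y') ∈ orbitRelOf φ :=
  ⟨fun h => orbitRelOf_trans (orbitRelOf_symm hx) (orbitRelOf_trans h hy),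
    fun h => orbitRelOf_trans hx (orbitRelOf_trans h (orbitRelOf_symm hy))⟩

theorem measure_image_orbit [MeasurableSpace X] [BorelSpace X] {μ : Measure X}
    (hinv : IsInvariantMeasure (orbitRelOf φ) μ) (g : G) (K : Set X) : μ (φ g '' K) = μ K := by
  have h := hinv (φ g) (orbitRelOf_apply φ g)
  conv_lhs => rw [← h]
  have h2 := MeasurableEquiv.map_apply (μ := μ) (φ g).toMeasurableEquiv (φ g '' K)
  rw [Homeomorph.toMeasurableEquiv_coe] at h2
  rw [h2, Set.preimage_image_eq _ (φ g).injective]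

theorem measure_ne_zero_of_isOpen_of_isMinimalRel [Countable G] [Nonempty X] [MeasurableSpace X]
    [BorelSpace X] {μ : Measure X} [IsProbabilityMeasure μ]
    (hmin : IsMinimalRel (orbitRelOf φ)) (hinv : IsInvariantMeasure (orbitRelOf φ) μ)
    {O : Set X} (hO : IsOpen O) (hne : O.Nonempty) : μ O ≠ 0 := by
  intro h0
  have hcov : (Set.univ : Set X) = ⋃ g : G, φ g '' O := by
    refine (Set.eq_univ_of_forall fun x => ?_).symm
    obtain ⟨y, hy, hyO⟩ := (hmin x).exists_mem_open hO hne
    obtain ⟨g, hg⟩ := orbitRelOf_symm hy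
    exact Set.mem_iUnion.2 ⟨g, y, hyO, hg⟩
  have h1 : μ Set.univ = 0 := by
    rw [hcov, measure_iUnion_null_iff]
    intro g
    rw [measure_image_orbit hinv, h0]
  simp at h1

end OrbitRelation

theorem prod_count_apply {X : Type*} [MeasurableSpace X] {n : ℕ} (μ : Measure X) [SFinite μ]
    {S : Set (X × Fin n)}
    (hS : MeasurableSet S) :
    (μ.prod Measure.count) S = ∑ j, μ {y | (y, j) ∈ S} := by
  rw [Measure.prod_apply_symm hS, lintegral_count, tsum_fintype]
  rfl

theorem prod_count_prod_singleton {X : Type*} [MeasurableSpace X] {n : ℕ} (μ : Measure X)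
    [SFinite μ] (K : Set X) (i : Fin n) :
    (μ.prod Measure.count) (K ×ˢ {i}) = μ K := by
  rw [Measure.prod_prod, Measure.count_singleton, mul_one]

theorem prod_count_range_prodMk_zero {X : Type*} [MeasurableSpace X] (μ : Measure X)
    [IsProbabilityMeasure μ] :
    (μ.prod Measure.count) (Set.range fun x : X => (x, (0 : Fin 1))) = 1 := by
  have : (Set.range fun x : X => (x, (0 : Fin 1))) = Set.univ ×ˢ {0} := by
    ext ⟨x, i⟩
    simp [eq_comm]
  rw [this, prod_count_prod_singleton, measure_univ]

/-- An open embedding of `X` into `X × {1,…,n}` carrying `R` onto the restriction of `R^n` to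
its range. -/
structure IsRelEmbedding {X : Type*} [TopologicalSpace X] (R : Set (X × X)) {n : ℕ}
    (α : X → X × Fin n) : Prop where
  isOpenEmbedding : Topology.IsOpenEmbedding α
  rel_iff : ∀ x y, (x, y) ∈ R ↔ ((α x).1, (α y).1) ∈ R

section Embedding

variable {X : Type*} [TopologicalSpace X]

theorem mem_fundGroup_iff [CompactSpace X] [T2Space X] [MeasurableSpace X] {R : Set (X × X)}
    {μ : Measure X} {l : ℝ} :
    l ∈ fundGroup R μ ↔ ∃ (n : ℕ) (α : X → X × Fin n), IsRelEmbedding R α ∧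
      l = ((μ.prod Measure.count) (Set.range α)).toReal := by
  constructor
  · rintro ⟨n, U, hU, ⟨F, hF⟩, rfl⟩
    refine ⟨n, Subtype.val ∘ F, ⟨hU.isOpen.isOpenEmbedding_subtypeVal.comp F.isOpenEmbedding, hF⟩,
      ?_⟩
    rw [Set.range_comp, F.surjective.range_eq, Set.image_univ, Subtype.range_coe]
  · rintro ⟨n, α, hα, rfl⟩
    refine ⟨n, Set.range α, ⟨(isCompact_range hα.isOpenEmbedding.continuous).isClosed,
      hα.isOpenEmbedding.isOpen_range⟩,
      ⟨hα.isOpenEmbedding.isEmbedding.toHomeomorph, hα.rel_iff⟩, rfl⟩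

/-- The composite of `β : X → X × {1,…,k}` with `α × id`, as a map into `X × {1,…,nk}`. -/
def prodEmbedding {n k : ℕ} (α : X → X × Fin n) (β : X → X × Fin k) (x : X) :
    X × Fin (n * k) :=
  ((α (β x).1).1, finProdFinEquiv ((α (β x).1).2, (β x).2))

theorem IsRelEmbedding.prod {R : Set (X × X)} {n k : ℕ} {α : X → X × Fin n}
    {β : X → X × Fin k} (hα : IsRelEmbedding R α) (hβ : IsRelEmbedding R β) :
    IsRelEmbedding R (prodEmbedding α β) where
  isOpenEmbedding := by
    let e : (Fin n × Fin k) ≃ₜ Fin (n * k) := finProdFinEquiv.toHomeomorphOfDiscrete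
    exact (((Homeomorph.refl X).prodCongr e).isOpenEmbedding.comp
      (Homeomorph.prodAssoc X (Fin n) (Fin k)).isOpenEmbedding).comp
        ((hα.isOpenEmbedding.prodMap Topology.IsOpenEmbedding.id).comp hβ.isOpenEmbedding)
  rel_iff x y := (hβ.rel_iff x y).trans (hα.rel_iff _ _)

variable [MeasurableSpace X] [BorelSpace X]

theorem IsRelEmbedding.measurableEmbedding {R : Set (X × X)} {n : ℕ} {α : X → X × Fin n}
    (hα : IsRelEmbedding R α) : MeasurableEmbedding α :=
  hα.isOpenEmbedding.measurableEmbedding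

variable [SecondCountableTopology X] {G : Type*} [Group G] [Countable G] {φ : G →* (X ≃ₜ X)}
  {μ : Measure X} [IsProbabilityMeasure μ]

/-- Two embeddings that agree modulo the orbit relation pull back the same measure. -/
theorem comap_eq_comap_of_orbitRel (hinv : IsInvariantMeasure (orbitRelOf φ) μ) {n k : ℕ}
    {α : X → X × Fin n} {β : X → X × Fin k} (hα : Topology.IsOpenEmbedding α)
    (hβ : Topology.IsOpenEmbedding β)
    (h : ∀ x, ((α x).1, (β x).1) ∈ orbitRelOf φ) :
    (μ.prod Measure.count).comap α = (μ.prod Measure.count).comap β := by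
  let C : Fin n × Fin k × G → Set X := fun p =>
    {x | (α x).2 = p.1 ∧ (β x).2 = p.2.1 ∧ φ p.2.2 (α x).1 = (β x).1}
  have hU : ⋃ p, C p = Set.univ := by
    refine Set.eq_univ_of_forall fun x => ?_
    obtain ⟨g, hg⟩ := h x
    exact Set.mem_iUnion.2 ⟨((α x).2, (β x).2, g), rfl, rfl, hg⟩
  refine (Measure.ext_iff_of_iUnion_eq_univ hU).2 fun p => ?_
  ext E hE
  rw [Measure.restrict_apply hE, Measure.restrict_apply hE, hα.measurableEmbedding.comap_apply,
    hβ.measurableEmbedding.comap_apply]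
  have h1 : α '' (E ∩ C p) = ((fun x => (α x).1) '' (E ∩ C p)) ×ˢ {p.1} := by
    ext ⟨y, i⟩
    constructor
    · rintro ⟨x, hx, hxy⟩
      refine ⟨⟨x, hx, by simp [hxy]⟩, ?_⟩
      have := hx.2.1
      rw [hxy] at this
      exact this
    · rintro ⟨⟨x, hx, hxy⟩, hi⟩
      exact ⟨x, hx, Prod.ext hxy (hx.2.1.trans hi.symm)⟩
  have h2 : β '' (E ∩ C p) = (φ p.2.2 '' ((fun x => (α x).1) '' (E ∩ C p))) ×ˢ {p.2.1} := by
    ext ⟨y, i⟩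
    constructor
    · rintro ⟨x, hx, hxy⟩
      refine ⟨⟨_, ⟨x, hx, rfl⟩, hx.2.2.2.trans (by simp [hxy])⟩, ?_⟩
      have := hx.2.2.1
      rw [hxy] at this
      exact this
    · rintro ⟨⟨_, ⟨x, hx, rfl⟩, hxy⟩, hi⟩
      exact ⟨x, hx, Prod.ext (hx.2.2.2.symm.trans hxy) (hx.2.2.1.trans hi.symm)⟩
  rw [h1, h2, prod_count_prod_singleton, prod_count_prod_singleton, measure_image_orbit hinv]

theorem prod_count_range_ne_zero [Nonempty X] (hmin : IsMinimalRel (orbitRelOf φ))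
    (hinv : IsInvariantMeasure (orbitRelOf φ) μ) {n : ℕ} {α : X → X × Fin n}
    (hα : Topology.IsOpenEmbedding α) : (μ.prod Measure.count) (Set.range α) ≠ 0 := by
  obtain ⟨x⟩ := ‹Nonempty X›
  have : Nonempty X := ⟨x⟩
  rw [prod_count_apply μ hα.measurableEmbedding.measurableSet_range]
  intro h0
  refine measure_ne_zero_of_isOpen_of_isMinimalRel (O := {y | (y, (α x).2) ∈ Set.range α}) hmin hinv
    (hα.isOpen_range.preimage (by fun_prop)) ⟨(α x).1, x, rfl⟩ ?_
  exact (Finset.sum_eq_zero_iff.1 h0) _ (Finset.mem_univ _)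

/-- Unique ergodicity forces an embedding of the orbit relation to scale the measure. -/
theorem IsRelEmbedding.measure_image [Nonempty X] (hmin : IsMinimalRel (orbitRelOf φ))
    (hinv : IsInvariantMeasure (orbitRelOf φ) μ)
    (huniq : ∀ ν : Measure X, IsProbabilityMeasure ν →
      IsInvariantMeasure (orbitRelOf φ) ν → ν = μ)
    {n : ℕ} {α : X → X × Fin n} (hα : IsRelEmbedding (orbitRelOf φ) α) (E : Set X) :
    (μ.prod Measure.count) (α '' E) = (μ.prod Measure.count) (Set.range α) * μ E := by
  set a := (μ.prod Measure.count) (Set.range α)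
  have ha0 : a ≠ 0 := prod_count_range_ne_zero hmin hinv hα.isOpenEmbedding
  have hat : a ≠ ∞ := measure_ne_top _ _
  have hcomap := hα.measurableEmbedding.comap_apply (μ.prod Measure.count)
  have key : a⁻¹ • (μ.prod Measure.count).comap α = μ := by
    refine huniq _ ⟨?_⟩ fun h hh => ?_
    · rw [Measure.smul_apply, hcomap, Set.image_univ, smul_eq_mul]
      exact ENNReal.inv_mul_cancel ha0 hat
    · rw [Measure.map_smul]
      congr 1
      ext E hE
      rw [Measure.map_apply h.continuous.measurable hE, hcomap]
      have hc := comap_eq_comap_of_orbitRel hinv hα.isOpenEmbedding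
        (hα.isOpenEmbedding.comp h.symm.isOpenEmbedding) fun x => by
          refine (hα.rel_iff _ _).1 (orbitRelOf_symm ?_)
          simpa using hh (h.symm x)
      rw [hc, (hα.isOpenEmbedding.comp h.symm.isOpenEmbedding).measurableEmbedding.comap_apply,
        Set.image_comp, h.image_symm]
  conv_rhs => rw [← key]
  rw [Measure.smul_apply, hcomap, smul_eq_mul, ← mul_assoc, ENNReal.mul_inv_cancel ha0 hat, one_mul]

theorem prod_count_range_prodEmbedding [Nonempty X] (hmin : IsMinimalRel (orbitRelOf φ))
    (hinv : IsInvariantMeasure (orbitRelOf φ) μ)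
    (huniq : ∀ ν : Measure X, IsProbabilityMeasure ν →
      IsInvariantMeasure (orbitRelOf φ) ν → ν = μ)
    {n k : ℕ} {α : X → X × Fin n} {β : X → X × Fin k} (hα : IsRelEmbedding (orbitRelOf φ) α)
    (hβ : IsRelEmbedding (orbitRelOf φ) β) :
    (μ.prod Measure.count) (Set.range (prodEmbedding α β)) =
      (μ.prod Measure.count) (Set.range α) * (μ.prod Measure.count) (Set.range β) := by
  have hβm := hβ.measurableEmbedding.measurableSet_range
  rw [prod_count_apply μ (hα.prod hβ).measurableEmbedding.measurableSet_range,
    prod_count_apply μ hβm, Finset.mul_sum,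
    ← finProdFinEquiv.sum_comp, Fintype.sum_prod_type_right]
  refine Finset.sum_congr rfl fun j _ => ?_
  have hm : MeasurableSet {y | (y, j) ∈ Set.range β} := hβm.preimage (by fun_prop)
  rw [← hα.measure_image hmin hinv huniq,
    prod_count_apply μ (hα.measurableEmbedding.measurableSet_image.2 hm)]
  refine Finset.sum_congr rfl fun i _ => ?_
  congr 1
  ext z
  constructor
  · rintro ⟨x, hx⟩
    simp only [prodEmbedding, Prod.mk.injEq, EmbeddingLike.apply_eq_iff_eq] at hx
    obtain ⟨h1, h2, h3⟩ := hx
    exact ⟨(β x).1, ⟨x, Prod.ext rfl h3⟩, Prod.ext h1 h2⟩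
  · rintro ⟨y, ⟨x, hx⟩, hy⟩
    refine ⟨x, ?_⟩
    simp [prodEmbedding, hx, hy]

end Embedding

section Inverse

variable {X : Type*} [TopologicalSpace X] [CompactSpace X] {G : Type*} [Group G] [Countable G]
  {φ : G →* (X ≃ₜ X)}

/-- Finitely many group elements, chosen in a locally constant way, move `X` into a given
nonempty clopen set. -/
theorem exists_continuous_mem_of_isMinimalRel (hmin : IsMinimalRel (orbitRelOf φ)) {O : Set X}
    (hO : IsClopen O) (hne : O.Nonempty) :
    ∃ (k : ℕ) (g : Fin k → G) (c : X → Fin k), Continuous c ∧ ∀ x, φ (g (c x)) x ∈ O := by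
  classical
  obtain ⟨e, he⟩ := exists_surjective_nat G
  have hex : ∀ x, ∃ m, φ (e m) x ∈ O := fun x => by
    obtain ⟨y, ⟨g, hg⟩, hy⟩ := (hmin x).exists_mem_open hO.isOpen hne
    obtain ⟨m, rfl⟩ := he g
    change φ (e m) x = y at hg
    exact ⟨m, hg ▸ hy⟩
  have hA : ∀ m, IsClopen {x | φ (e m) x ∈ O} := fun m => hO.preimage (φ (e m)).continuous
  have hc : Continuous fun x => Nat.find (hex x) := by
    refine continuous_discrete_rng.2 fun m => ?_
    have : (fun x => Nat.find (hex x)) ⁻¹' {m} =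
        {x | φ (e m) x ∈ O} ∩ ⋂ i ∈ Set.Iio m, {x | φ (e i) x ∈ O}ᶜ := by
      ext x
      simp [Nat.find_eq_iff]
    rw [this]
    exact (hA m).isOpen.inter
      ((Set.finite_Iio m).isOpen_biInter fun i _ => (hA i).compl.isOpen)
  obtain ⟨N, hN⟩ := (isCompact_range hc).bddAbove
  have hlt : ∀ x, Nat.find (hex x) < N + 1 := fun x => Nat.lt_succ_of_le (hN ⟨x, rfl⟩)
  refine ⟨N + 1, fun i => e i, fun x => ⟨Nat.find (hex x), hlt x⟩, ?_,
    fun x => Nat.find_spec (hex x)⟩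
  refine continuous_discrete_rng.2 fun i => ?_
  convert (isOpen_discrete {(i : ℕ)}).preimage hc using 1
  ext x
  simp [Fin.ext_iff]

/-- For every embedding `α` there is `β` such that the composite is the identity modulo the
orbit relation. -/
theorem IsRelEmbedding.exists_inverse [T2Space X] [Nonempty X]
    (hmin : IsMinimalRel (orbitRelOf φ)) {n : ℕ}
    {α : X → X × Fin n} (hα : IsRelEmbedding (orbitRelOf φ) α) :
    ∃ (k : ℕ) (β : X → X × Fin k), IsRelEmbedding (orbitRelOf φ) β ∧
      ∀ x, (x, (prodEmbedding α β x).1) ∈ orbitRelOf φ := by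
  obtain ⟨x₀⟩ := ‹Nonempty X›
  set j := (α x₀).2
  have hclopen : IsClopen (Set.range α) :=
    ⟨(isCompact_range hα.isOpenEmbedding.continuous).isClosed, hα.isOpenEmbedding.isOpen_range⟩
  obtain ⟨k, g, c, hc, hmem⟩ := exists_continuous_mem_of_isMinimalRel hmin
    (O := {y | (y, j) ∈ Set.range α}) (hclopen.preimage (by fun_prop)) ⟨(α x₀).1, x₀, rfl⟩
  have hg : Continuous fun x => φ (g (c x)) x := by
    have h : Continuous fun p : Fin k × X => φ (g p.1) p.2 :=
      continuous_prod_of_discrete_left.2 fun i => (φ (g i)).continuous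
    exact h.comp (hc.prodMk continuous_id)
  let e := hα.isOpenEmbedding.isEmbedding.toHomeomorph
  let b : X → X := fun x => e.symm ⟨(φ (g (c x)) x, j), hmem x⟩
  have hb : Continuous b := e.symm.continuous.comp
    ((hg.prodMk continuous_const).subtype_mk hmem)
  have hαb : ∀ x, α (b x) = (φ (g (c x)) x, j) := fun x =>
    congrArg Subtype.val (e.apply_symm_apply ⟨(φ (g (c x)) x, j), hmem x⟩)
  have hβc : Continuous fun x => (b x, c x) := hb.prodMk hc
  have hrel : ∀ x, (x, (α (b x)).1) ∈ orbitRelOf φ := fun x => by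
    rw [hαb]
    exact orbitRelOf_apply φ _ x
  have hinj : Function.Injective fun x => (b x, c x) := by
    intro x y hxy
    simp only [Prod.mk.injEq] at hxy
    have h := hαb x
    rw [hxy.1, hαb y, hxy.2] at h
    exact ((φ _).injective (congrArg Prod.fst h)).symm
  have hrange : Set.range (fun x => (b x, c x)) =
      ⋃ i : Fin k, {p : X × Fin k | p.2 = i ∧ (α p.1).2 = j ∧
        c ((φ (g i)).symm (α p.1).1) = i} := by
    ext ⟨y, i⟩
    simp only [Set.mem_iUnion, Set.mem_ofPred_eq, Set.mem_range, Prod.mk.injEq]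
    constructor
    · rintro ⟨x, rfl, rfl⟩
      refine ⟨c x, rfl, ?_, ?_⟩
      · rw [hαb]
      · rw [hαb, Homeomorph.symm_apply_apply]
    · rintro ⟨i, rfl, hj, hi⟩
      refine ⟨_, hα.isOpenEmbedding.injective ?_, hi⟩
      rw [hαb, hi, Homeomorph.apply_symm_apply, ← hj]
  have hopen : IsOpen (Set.range fun x => (b x, c x)) := by
    rw [hrange]
    have hαc := hα.isOpenEmbedding.continuous
    refine isOpen_iUnion fun i => ?_
    have h1 : Continuous fun p : X × Fin k =>
        (p.2, (α p.1).2, c ((φ (g i)).symm (α p.1).1)) := by fun_prop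
    convert (isOpen_discrete {(i, j, i)}).preimage h1 using 1
    ext p
    simp
  refine ⟨k, fun x => (b x, c x),
    ⟨⟨(hβc.isClosedEmbedding hinj).isEmbedding, hopen⟩, fun x y => ?_⟩, hrel⟩
  exact (orbitRelOf_congr (hrel x) (hrel y)).trans (hα.rel_iff _ _).symm

end Inverse

theorem isRelEmbedding_prodMk_zero {X : Type*} [TopologicalSpace X] (R : Set (X × X)) :
    IsRelEmbedding R fun x => (x, (0 : Fin 1)) where
  isOpenEmbedding := (Homeomorph.prodUnique X (Fin 1)).symm.isOpenEmbedding
  rel_iff _ _ := Iff.rfl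

theorem fundGroup_countable {X : Type*} [TopologicalSpace X] [CompactSpace X]
    [T2Space X] [TotallyDisconnectedSpace X] [SecondCountableTopology X] [MeasurableSpace X]
    (R : Set (X × X)) (μ : Measure X) :
    (fundGroup R μ).Countable := by
  have hclopens : ∀ n, Countable (TopologicalSpace.Clopens (X × Fin n)) := fun _ =>
    TopologicalSpace.Clopens.countable_iff_secondCountable.2 inferInstance
  have hsub : fundGroup R μ ⊆ ⋃ n : ℕ, Set.range fun U : TopologicalSpace.Clopens (X × Fin n) =>
      ((μ.prod Measure.count) (U : Set (X × Fin n))).toReal := by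
    rintro l ⟨n, U, hU, -, rfl⟩
    exact Set.mem_iUnion.2 ⟨n, ⟨U, hU⟩, rfl⟩
  exact (Set.countable_iUnion fun n => Set.countable_range _).mono hsub

/-- The fundamental group of a uniquely ergodic Cantor minimal `G`-system is
a countable multiplicative subgroup of `ℝ₊^×`. -/
theorem statement6 {G : Type*} [Group G] [Countable G] {X : Type*} [TopologicalSpace X] [CompactSpace X]
    [TopologicalSpace.MetrizableSpace X] [TotallyDisconnectedSpace X] [Nonempty X]
    [MeasurableSpace X] [BorelSpace X]
    (hperf : Perfect (Set.univ : Set X))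
    (φ : G →* (X ≃ₜ X)) (hfree : IsFreeAction φ) (hmin : IsMinimalRel (orbitRelOf φ))
    (μ : Measure X) [IsProbabilityMeasure μ] (hinv : IsInvariantMeasure (orbitRelOf φ) μ)
    (huniq : ∀ ν : Measure X, IsProbabilityMeasure ν → IsInvariantMeasure (orbitRelOf φ) ν → ν = μ) :
    (1 : ℝ) ∈ fundGroup (orbitRelOf φ) μ ∧
    (∀ a ∈ fundGroup (orbitRelOf φ) μ, 0 < a) ∧
    (∀ a ∈ fundGroup (orbitRelOf φ) μ, ∀ b ∈ fundGroup (orbitRelOf φ) μ,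
      a * b ∈ fundGroup (orbitRelOf φ) μ) ∧
    (∀ a ∈ fundGroup (orbitRelOf φ) μ, a⁻¹ ∈ fundGroup (orbitRelOf φ) μ) ∧
    (fundGroup (orbitRelOf φ) μ).Countable := by
  let _ := TopologicalSpace.metrizableSpaceMetric X
  have : SecondCountableTopology X := inferInstance
  refine ⟨?_, ?_, ?_, ?_, fundGroup_countable _ μ⟩
  · refine mem_fundGroup_iff.2 ⟨1, _, isRelEmbedding_prodMk_zero _, ?_⟩
    rw [prod_count_range_prodMk_zero, ENNReal.toReal_one]
  · intro a ha
    obtain ⟨n, α, hα, rfl⟩ := mem_fundGroup_iff.1 ha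
    exact ENNReal.toReal_pos (prod_count_range_ne_zero hmin hinv hα.isOpenEmbedding)
      (measure_ne_top _ _)
  · intro a ha b hb
    obtain ⟨n, α, hα, rfl⟩ := mem_fundGroup_iff.1 ha
    obtain ⟨k, β, hβ, rfl⟩ := mem_fundGroup_iff.1 hb
    refine mem_fundGroup_iff.2 ⟨_, _, hα.prod hβ, ?_⟩
    rw [prod_count_range_prodEmbedding hmin hinv huniq hα hβ, ENNReal.toReal_mul]
  · intro a ha
    obtain ⟨n, α, hα, rfl⟩ := mem_fundGroup_iff.1 ha
    obtain ⟨k, β, hβ, hαβ⟩ := hα.exists_inverse hmin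
    refine mem_fundGroup_iff.2 ⟨k, β, hβ, ?_⟩
    have hγ := hα.prod hβ
    have hι := isRelEmbedding_prodMk_zero (orbitRelOf φ)
    have h := congrArg (fun ν : Measure X => ν Set.univ)
      (comap_eq_comap_of_orbitRel hinv hι.isOpenEmbedding hγ.isOpenEmbedding hαβ)
    simp only [hι.measurableEmbedding.comap_apply, hγ.measurableEmbedding.comap_apply,
      Set.image_univ, prod_count_range_prodMk_zero,
      prod_count_range_prodEmbedding hmin hinv huniq hα hβ] at h
    refine inv_eq_of_mul_eq_one_right ?_
    rw [← ENNReal.toReal_mul, ← h, ENNReal.toReal_one]
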